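/- arXiv:math/0212176 — 5 statements merged into one kernel-verified Lean document; each statement's English description precedes it below -/
import Mathlib

section
/- Let B ⊆ ℂ² be an open ball centered at the origin, let r ≥ 1, and let φ be a map from B ∖ {0} to the r×r complex matrices which is analytic on B ∖ {0} and such that φ(z) is an invertible matrix for every z ∈ B ∖ {0}. Then there exists a map Φ from B to the r×r complex matrices, analytic on B, which agrees with φ on B ∖ {0} and such that Φ(z) is invertible for every z ∈ B. -/
open MeasureTheory Metric Topology

/-- The distinguished boundary of the bidisc of radius `ρ`. -/
abbrev Torus (ρ : ℝ) : Type := sphere (0 : ℂ) ρ × sphere (0 : ℂ) ρ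

/-- The standard parametrization of the circle `|ζ| = ρ`, as a map into the sphere. -/
noncomputable def circleParam (ρ : ℝ) (hρ : 0 < ρ) : C(ℝ, sphere (0 : ℂ) ρ) where
  toFun θ := ⟨circleMap 0 ρ θ, circleMap_mem_sphere 0 hρ.le θ⟩
  continuous_toFun := (continuous_circleMap 0 ρ).subtype_mk _

/-- The integrand, in polar coordinates, of the double circle integral of `g` over a torus. -/
noncomputable def torusIntegrand (ρ : ℝ) (hρ : 0 < ρ)
    (g : C(Torus ρ, ℂ)) (η θ : ℝ) : ℂ :=
  deriv (circleMap 0 ρ) η * (deriv (circleMap 0 ρ) θ *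
    g (circleParam ρ hρ θ, circleParam ρ hρ η))

theorem continuous_torusIntegrand (ρ : ℝ) (hρ : 0 < ρ)
    (g : C(Torus ρ, ℂ)) :
    Continuous (Function.uncurry (torusIntegrand ρ hρ g)) := by
  unfold torusIntegrand Function.uncurry
  simp only [deriv_circleMap]
  fun_prop

theorem continuous_integral_torusIntegrand (ρ : ℝ) (hρ : 0 < ρ)
    (g : C(Torus ρ, ℂ)) :
    Continuous fun η => ∫ θ in (0 : ℝ)..2 * Real.pi, torusIntegrand ρ hρ g η θ :=
  intervalIntegral.continuous_parametric_intervalIntegral_of_continuous'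
    (continuous_torusIntegrand ρ hρ g) _ _

theorem norm_torusIntegrand_le (ρ : ℝ) (hρ : 0 < ρ)
    (g : C(Torus ρ, ℂ)) (η θ : ℝ) :
    ‖torusIntegrand ρ hρ g η θ‖ ≤ ρ * (ρ * ‖g‖) := by
  simp only [torusIntegrand, deriv_circleMap, norm_mul, norm_circleMap_zero, Complex.norm_I,
    mul_one, abs_of_pos hρ]
  gcongr
  exact g.norm_coe_le_norm _

/-- The double circle integral over a torus, as a continuous linear functional. -/
noncomputable def torusIntegralCLM (ρ : ℝ) (hρ : 0 < ρ) :
    C(Torus ρ, ℂ) →L[ℂ] ℂ :=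
  LinearMap.mkContinuous
    { toFun := fun g => ∫ η in (0 : ℝ)..2 * Real.pi, ∫ θ in (0 : ℝ)..2 * Real.pi,
        torusIntegrand ρ hρ g η θ
      map_add' := fun g h => by
        have slice (k) (η : ℝ) : Continuous (torusIntegrand ρ hρ k η) :=
          (continuous_torusIntegrand ρ hρ k).comp (Continuous.prodMk_right η)
        rw [← intervalIntegral.integral_add
          ((continuous_integral_torusIntegrand ρ hρ g).intervalIntegrable _ _)
          ((continuous_integral_torusIntegrand ρ hρ h).intervalIntegrable _ _)]
        congr 1 with η
        rw [← intervalIntegral.integral_add ((slice g η).intervalIntegrable _ _)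
          ((slice h η).intervalIntegrable _ _)]
        congr 1 with θ
        simp only [torusIntegrand, ContinuousMap.add_apply]
        ring
      map_smul' := fun c g => by
        simp only [RingHom.id_apply, ← intervalIntegral.integral_smul]
        congr 1 with η
        congr 1 with θ
        simp only [torusIntegrand, ContinuousMap.smul_apply, smul_eq_mul]
        ring }
    (ρ * ρ * |2 * Real.pi - 0| * |2 * Real.pi - 0|)
    fun g => by
      refine (intervalIntegral.norm_integral_le_of_norm_le_const fun η _ =>
        intervalIntegral.norm_integral_le_of_norm_le_const fun θ _ =>
          norm_torusIntegrand_le ρ hρ g η θ).trans_eq ?_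
      ring

theorem torusIntegralCLM_apply (ρ : ℝ) (hρ : 0 < ρ)
    (g : C(Torus ρ, ℂ)) (G : ℂ → ℂ → ℂ)
    (hG : ∀ p, g p = G p.1 p.2) :
    torusIntegralCLM ρ hρ g = ∮ ω in C(0, ρ), ∮ ζ in C(0, ρ), G ζ ω := by
  change (∫ η in (0 : ℝ)..2 * Real.pi, ∫ θ in (0 : ℝ)..2 * Real.pi,
    torusIntegrand ρ hρ g η θ) = _
  simp only [circleIntegral, torusIntegrand, hG, smul_eq_mul,
    intervalIntegral.integral_const_mul]
  rfl

/-- The Cauchy kernel `(c - l q)⁻¹` is analytic in `q`, as an element of the Banach algebra of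
continuous functions. -/
theorem analyticAt_inverse_sub_smul {X : Type*} [TopologicalSpace X] [CompactSpace X]
    {E : Type*} [NormedAddCommGroup E] [NormedSpace ℂ E] (c : C(X, ℂ)) (l : E →L[ℂ] ℂ)
    {p : E} (hp : ∀ x, c x ≠ l p) :
    AnalyticAt ℂ (fun q => Ring.inverse (c - l q • (1 : C(X, ℂ)))) p := by
  have hu : IsUnit (c - l p • (1 : C(X, ℂ))) := by
    rw [ContinuousMap.isUnit_iff_forall_ne_zero]
    intro x
    simpa [sub_eq_zero] using hp x
  obtain ⟨u, hu⟩ := hu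
  have h1 : AnalyticAt ℂ (fun q => c - l q • (1 : C(X, ℂ))) p :=
    analyticAt_const.sub ((l.analyticAt p).smul analyticAt_const)
  have h2 : AnalyticAt ℂ Ring.inverse (c - l p • (1 : C(X, ℂ))) := by
    rw [← hu]; exact analyticAt_inverse u
  exact h2.comp (f := fun q => c - l q • (1 : C(X, ℂ))) h1

theorem inverse_sub_smul_apply {X : Type*} [TopologicalSpace X] [CompactSpace X]
    (c : C(X, ℂ)) {z : ℂ} (hz : ∀ x, c x ≠ z) (x : X) :
    Ring.inverse (c - z • (1 : C(X, ℂ))) x = (c x - z)⁻¹ := by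
  have hu : IsUnit (c - z • (1 : C(X, ℂ))) := by
    rw [ContinuousMap.isUnit_iff_forall_ne_zero]
    intro x
    simpa [sub_eq_zero] using hz x
  have := congrArg (fun f : C(X, ℂ) => f x) (Ring.mul_inverse_cancel _ hu)
  exact eq_inv_of_mul_eq_one_right (by simpa using this)

theorem ne_of_mem_sphere_of_mem_ball {ρ : ℝ} {z : ℂ} (hz : ‖z‖ < ρ) (x : sphere (0 : ℂ) ρ) :
    (x : ℂ) ≠ z := by
  rintro rfl
  have := x.2
  simp only [mem_sphere_iff_norm, sub_zero] at this
  exact hz.ne this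

/-- Hartogs extension across a point, on a bidisc. -/
theorem exists_analyticAt_extension_bidisc {ρ : ℝ} (hρ : 0 < ρ) {f : ℂ × ℂ → ℂ}
    (hf : ∀ p ∈ closedBall (0 : ℂ × ℂ) ρ \ {0}, AnalyticAt ℂ f p) :
    ∃ g : ℂ × ℂ → ℂ, AnalyticAt ℂ g 0 ∧ ∀ p ∈ ball (0 : ℂ × ℂ) ρ \ {0}, g p = f p := by
  have hf' : ∀ a b : ℂ, ‖a‖ ≤ ρ → ‖b‖ ≤ ρ → (a ≠ 0 ∨ b ≠ 0) → AnalyticAt ℂ f (a, b) := by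
    intro a b ha hb hab
    refine hf _ ⟨by simp [Prod.norm_def, ha, hb], ?_⟩
    simp only [Set.mem_singleton_iff, Prod.mk_eq_zero]
    tauto
  have norm_sphere (x : sphere (0 : ℂ) ρ) : ‖(x : ℂ)‖ = ρ := by simp
  have sphere_ne (x : sphere (0 : ℂ) ρ) : (x : ℂ) ≠ 0 := ne_of_mem_sphere_of_mem_ball (by simpa) x
  let fT : C(Torus ρ, ℂ) := ⟨fun p => f (p.1, p.2), continuous_iff_continuousAt.2 fun p =>
    (hf' p.1 p.2 (norm_sphere _).le (norm_sphere _).le (.inl (sphere_ne _))).continuousAt.comp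
      (f := fun p : Torus ρ => ((p.1 : ℂ), (p.2 : ℂ))) (by fun_prop)⟩
  let c₁ : C(Torus ρ, ℂ) := ⟨fun p => p.1, by fun_prop⟩
  let c₂ : C(Torus ρ, ℂ) := ⟨fun p => p.2, by fun_prop⟩
  let g : ℂ × ℂ → ℂ := fun p => (2 * Real.pi * Complex.I)⁻¹ * (2 * Real.pi * Complex.I)⁻¹ *
    torusIntegralCLM ρ hρ (Ring.inverse (c₂ - p.2 • (1 : C(Torus ρ, ℂ))) *
      (Ring.inverse (c₁ - p.1 • (1 : C(Torus ρ, ℂ))) * fT))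
  have hg : ∀ p ∈ ball (0 : ℂ × ℂ) ρ, AnalyticAt ℂ g p := by
    intro p hp
    rw [mem_ball_zero_iff, Prod.norm_def, max_lt_iff] at hp
    have h₁ := analyticAt_inverse_sub_smul c₁ (ContinuousLinearMap.fst ℂ ℂ ℂ) (p := p)
      fun x => ne_of_mem_sphere_of_mem_ball hp.1 x.1
    have h₂ := analyticAt_inverse_sub_smul c₂ (ContinuousLinearMap.snd ℂ ℂ ℂ) (p := p)
      fun x => ne_of_mem_sphere_of_mem_ball hp.2 x.2
    exact analyticAt_const.mul
      ((torusIntegralCLM ρ hρ).analyticAt _ |>.comp (h₂.mul (h₁.mul analyticAt_const)))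
  have eq_of_fst_ne : ∀ z w : ℂ, ‖z‖ < ρ → ‖w‖ < ρ → z ≠ 0 → g (z, w) = f (z, w) := by
    intro z w hz hw hz0
    have cauchy_fst : ∀ ω ∈ sphere (0 : ℂ) ρ,
        ∮ ζ in C(0, ρ), (ω - w)⁻¹ * ((ζ - z)⁻¹ * f (ζ, ω)) =
          2 * Real.pi * Complex.I * ((ω - w)⁻¹ • f (z, ω)) := by
      intro ω hω
      have hd : DifferentiableOn ℂ (fun ζ => f (ζ, ω)) (closedBall 0 ρ) := fun ζ hζ =>
        ((hf' ζ ω (by simpa using hζ) (by simpa using hω.le)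
          (.inr (sphere_ne ⟨ω, hω⟩))).differentiableAt.comp ζ
            (f := fun ζ => (ζ, ω)) (by fun_prop)).differentiableWithinAt
      have := hd.circleIntegral_sub_inv_smul (w := z) (by simpa using hz)
      simp only [smul_eq_mul] at this ⊢
      rw [circleIntegral.integral_const_mul, this]
      ring
    have hd : DifferentiableOn ℂ (fun ω => f (z, ω)) (closedBall 0 ρ) := fun ω hω =>
      ((hf' z ω hz.le (by simpa using hω) (.inl hz0)).differentiableAt.comp ω
        (f := fun ω => (z, ω)) (by fun_prop)).differentiableWithinAt
    have cauchy_snd := hd.circleIntegral_sub_inv_smul (w := w) (by simpa using hw)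
    have hΛ := torusIntegralCLM_apply ρ hρ (Ring.inverse (c₂ - w • (1 : C(Torus ρ, ℂ))) *
      (Ring.inverse (c₁ - z • (1 : C(Torus ρ, ℂ))) * fT))
      (fun ζ ω => (ω - w)⁻¹ * ((ζ - z)⁻¹ * f (ζ, ω))) (fun p => by
        rw [ContinuousMap.mul_apply, ContinuousMap.mul_apply,
          inverse_sub_smul_apply c₁ fun x => ne_of_mem_sphere_of_mem_ball hz x.1,
          inverse_sub_smul_apply c₂ fun x => ne_of_mem_sphere_of_mem_ball hw x.2]
        rfl)
    rw [circleIntegral.integral_congr hρ.le cauchy_fst, circleIntegral.integral_const_mul,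
      cauchy_snd] at hΛ
    simp only [g, hΛ, smul_eq_mul]
    field_simp
  refine ⟨g, hg 0 (mem_ball_self hρ), fun ⟨z, w⟩ hp => ?_⟩
  have hp' := hp.1
  rw [mem_ball_zero_iff, Prod.norm_def, max_lt_iff] at hp'
  by_cases hz : z = 0
  · subst hz
    have hcurve : ContinuousAt (fun ζ : ℂ => (ζ, w)) 0 := by fun_prop
    have hgc : ContinuousAt (fun ζ => g (ζ, w)) 0 :=
      (hg _ hp.1).continuousAt.comp (f := fun ζ => (ζ, w)) hcurve
    have hfc : ContinuousAt (fun ζ => f (ζ, w)) 0 :=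
      (hf _ ⟨ball_subset_closedBall hp.1, hp.2⟩).continuousAt.comp (f := fun ζ => (ζ, w)) hcurve
    refine tendsto_nhds_unique_of_eventuallyEq (hgc.tendsto.mono_left nhdsWithin_le_nhds)
      (hfc.tendsto.mono_left nhdsWithin_le_nhds) (l := 𝓝[≠] (0 : ℂ)) ?_
    filter_upwards [self_mem_nhdsWithin, mem_nhdsWithin_of_mem_nhds (ball_mem_nhds 0 hρ)]
      with ζ h0 hζ
    exact eq_of_fst_ne ζ w (by simpa using hζ) hp'.2 h0
  · exact eq_of_fst_ne z w hp'.1 hp'.2 hz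

/-- Hartogs extension across a point of the Euclidean space `ℂ²`, in terms of germs. -/
theorem exists_analyticAt_eventuallyEq_of_analyticAt_punctured {R : ℝ} (hR : 0 < R)
    {f : EuclideanSpace ℂ (Fin 2) → ℂ}
    (hf : ∀ z ∈ ball (0 : EuclideanSpace ℂ (Fin 2)) R \ {0}, AnalyticAt ℂ f z) :
    ∃ g : EuclideanSpace ℂ (Fin 2) → ℂ, AnalyticAt ℂ g 0 ∧ g =ᶠ[𝓝[≠] 0] f := by
  let e : EuclideanSpace ℂ (Fin 2) ≃L[ℂ] ℂ × ℂ :=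
    (EuclideanSpace.equiv (Fin 2) ℂ).trans (ContinuousLinearEquiv.finTwoArrow ℂ ℂ)
  have he : ∀ p ∈ closedBall (0 : ℂ × ℂ) (R / 2) \ {0},
      e.symm p ∈ ball (0 : EuclideanSpace ℂ (Fin 2)) R \ {0} := by
    rintro p ⟨hp, hp0⟩
    refine ⟨?_, by simpa using hp0⟩
    rw [mem_closedBall_zero_iff, Prod.norm_def, max_le_iff] at hp
    have h0 : e.symm p 0 = p.1 := rfl
    have h1 : e.symm p 1 = p.2 := rfl
    rw [mem_ball_zero_iff, EuclideanSpace.norm_eq, Real.sqrt_lt' hR, Fin.sum_univ_two, h0, h1]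
    nlinarith [norm_nonneg p.1, norm_nonneg p.2]
  obtain ⟨g, hg, hgf⟩ := exists_analyticAt_extension_bidisc (half_pos hR)
    (f := f ∘ e.symm) fun p hp => (hf _ (he p hp)).comp (e.symm.toContinuousLinearMap.analyticAt p)
  refine ⟨g ∘ e, ?_, ?_⟩
  · refine AnalyticAt.comp ?_ (e.toContinuousLinearMap.analyticAt 0)
    simpa using hg
  · have hb : e ⁻¹' ball 0 (R / 2) ∈ 𝓝 0 :=
      e.continuous.continuousAt.preimage_mem_nhds (by simpa using ball_mem_nhds _ (half_pos hR))
    filter_upwards [self_mem_nhdsWithin, mem_nhdsWithin_of_mem_nhds hb] with z hz0 hz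
    have := hgf (e z) ⟨hz, by simpa using hz0⟩
    simpa using this

theorem AnalyticAt.matrix_det {𝕜 E : Type*} [NontriviallyNormedField 𝕜] [NormedAddCommGroup E]
    [NormedSpace 𝕜 E] {n : Type*} [Fintype n] [DecidableEq n] {A : E → Matrix n n 𝕜} {z : E}
    (hA : ∀ i j, AnalyticAt 𝕜 (fun w => A w i j) z) :
    AnalyticAt 𝕜 (fun w => (A w).det) z := by
  simp only [Matrix.det_apply']
  exact Finset.analyticAt_fun_sum _ fun σ _ =>
    analyticAt_const.mul (Finset.analyticAt_fun_prod _ fun i _ => hA _ _)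

/-- A holomorphic map from a punctured ball in `ℂ²` to invertible `r × r`
complex matrices extends to a holomorphic map on the whole ball with invertible values
(Hartogs extension of a bundle isomorphism across the center of a 4-ball). -/
theorem holomorphic_gl_extension_across_point
    (r : ℕ) (hr : 1 ≤ r) (R : ℝ) (hR : 0 < R)
    (φ : EuclideanSpace ℂ (Fin 2) → Matrix (Fin r) (Fin r) ℂ)
    (hφ : ∀ z ∈ Metric.ball (0 : EuclideanSpace ℂ (Fin 2)) R \ {0},
      ∀ i j, AnalyticAt ℂ (fun w => φ w i j) z)
    (hinv : ∀ z ∈ Metric.ball (0 : EuclideanSpace ℂ (Fin 2)) R \ {0}, IsUnit (φ z)) :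
    ∃ Φ : EuclideanSpace ℂ (Fin 2) → Matrix (Fin r) (Fin r) ℂ,
      (∀ z ∈ Metric.ball (0 : EuclideanSpace ℂ (Fin 2)) R,
        ∀ i j, AnalyticAt ℂ (fun w => Φ w i j) z) ∧
      (∀ z ∈ Metric.ball (0 : EuclideanSpace ℂ (Fin 2)) R \ {0}, Φ z = φ z) ∧
      (∀ z ∈ Metric.ball (0 : EuclideanSpace ℂ (Fin 2)) R, IsUnit (Φ z)) := by
  classical
  choose g hg hgφ using fun i j =>
    exists_analyticAt_eventuallyEq_of_analyticAt_punctured hR fun z hz => hφ z hz i j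
  obtain ⟨d, hd, hdφ⟩ := exists_analyticAt_eventuallyEq_of_analyticAt_punctured hR
    (f := fun z => ((φ z).det)⁻¹) fun z hz => (AnalyticAt.matrix_det (hφ z hz)).inv
      ((Matrix.isUnit_iff_isUnit_det _).1 (hinv z hz)).ne_zero
  let G : EuclideanSpace ℂ (Fin 2) → Matrix (Fin r) (Fin r) ℂ := fun z i j => g i j z
  let Φ : EuclideanSpace ℂ (Fin 2) → Matrix (Fin r) (Fin r) ℂ := Function.update φ 0 (G 0)
  have hΦφ : ∀ z, z ≠ 0 → Φ z = φ z := fun z hz => Function.update_of_ne hz _ _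
  have hΦ0 : Φ 0 = G 0 := Function.update_self _ _ _
  have hball : Metric.ball (0 : EuclideanSpace ℂ (Fin 2)) R ∈ 𝓝[≠] 0 :=
    mem_nhdsWithin_of_mem_nhds (Metric.ball_mem_nhds 0 hR)
  refine ⟨Φ, fun z hz i j => ?_, fun z hz => hΦφ z hz.2, fun z hz => ?_⟩
  · by_cases h0 : z = 0
    · subst h0
      refine (hg i j).congr ?_
      filter_upwards [eventually_nhdsWithin_iff.1 (hgφ i j)] with w hw
      by_cases hw0 : w = 0
      · rw [hw0, hΦ0]
      · rw [hw hw0, hΦφ w hw0]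
    · refine (hφ z ⟨hz, h0⟩ i j).congr ?_
      filter_upwards [isOpen_ne.mem_nhds h0] with w hw
      rw [hΦφ w hw]
  · by_cases h0 : z = 0
    · subst h0
      rw [hΦ0, Matrix.isUnit_iff_isUnit_det]
      have hdet : AnalyticAt ℂ (fun w => (G w).det) 0 := AnalyticAt.matrix_det hg
      have : (𝓝[≠] (0 : EuclideanSpace ℂ (Fin 2))).NeBot := Module.punctured_nhds_neBot ℂ _ 0
      have hone : (G 0).det * d 0 = 1 := by
        refine tendsto_nhds_unique_of_eventuallyEq
          ((hdet.mul hd).continuousAt.tendsto.mono_left nhdsWithin_le_nhds)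
          tendsto_const_nhds (l := 𝓝[≠] (0 : EuclideanSpace ℂ (Fin 2))) ?_
        have hGφ : ∀ᶠ w in 𝓝[≠] (0 : EuclideanSpace ℂ (Fin 2)), ∀ i j, g i j w = φ w i j :=
          Filter.eventually_all.2 fun i => Filter.eventually_all.2 fun j => hgφ i j
        filter_upwards [hGφ, hdφ, hball, self_mem_nhdsWithin] with w hGw hdw hw hw0
        have hGw' : G w = φ w := Matrix.ext hGw
        have := ((Matrix.isUnit_iff_isUnit_det _).1 (hinv w ⟨hw, hw0⟩)).ne_zero
        simp only [Pi.mul_apply, hGw', hdw]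
        exact mul_inv_cancel₀ this
      exact IsUnit.of_mul_eq_one _ hone
    · rw [hΦφ z h0]
      exact hinv z ⟨hz, h0⟩
end

section
/- Let m̃ = (a₁, a₂, d, b, c) be a blow-up monad configuration, and let (x₁, x₂, x₃, y₁, y₂) ∈ ℂ⁵ satisfy x₁y₁ + x₂y₂ = 0. Then the composition B_{m̃}(x₁,x₂,x₃,y₁,y₂) ∘ A_{m̃}(x₁,x₂,x₃,y₁,y₂) : W₁ ⊕ W₀ → W₀ ⊕ W₁ is the zero map. -/
/-- The blow-up monad map `A_m̃(x₁,x₂,x₃,y₁,y₂) : W₁ ⊕ W₀ → W₀ ⊕ W₁ ⊕ W₀ ⊕ W₁ ⊕ ℂʳ`. -/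
noncomputable def blowupA {W₀ W₁ : Type*} [AddCommGroup W₀] [Module ℂ W₀]
    [AddCommGroup W₁] [Module ℂ W₁] {r : ℕ}
    (a₁ a₂ : W₁ →ₗ[ℂ] W₀) (d : W₀ →ₗ[ℂ] W₁) (c : W₁ →ₗ[ℂ] (Fin r → ℂ))
    (x₁ x₂ x₃ y₁ y₂ : ℂ) :
    (W₁ × W₀) →ₗ[ℂ] (W₀ × W₁ × W₀ × W₁ × (Fin r → ℂ)) :=
  LinearMap.prod
    ((x₃ • a₁).comp (LinearMap.fst ℂ W₁ W₀)
      - (y₂ • LinearMap.id).comp (LinearMap.snd ℂ W₁ W₀))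
    (LinearMap.prod
      ((x₁ • LinearMap.id - x₃ • (d ∘ₗ a₁)).comp (LinearMap.fst ℂ W₁ W₀))
      (LinearMap.prod
        ((x₃ • a₂).comp (LinearMap.fst ℂ W₁ W₀)
          + (y₁ • LinearMap.id).comp (LinearMap.snd ℂ W₁ W₀))
        (LinearMap.prod
          ((x₂ • LinearMap.id - x₃ • (d ∘ₗ a₂)).comp (LinearMap.fst ℂ W₁ W₀))
          ((x₃ • c).comp (LinearMap.fst ℂ W₁ W₀)))))

/-- The blow-up monad map `B_m̃(x₁,x₂,x₃,y₁,y₂) : W₀ ⊕ W₁ ⊕ W₀ ⊕ W₁ ⊕ ℂʳ → W₀ ⊕ W₁`. -/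
noncomputable def blowupB {W₀ W₁ : Type*} [AddCommGroup W₀] [Module ℂ W₀]
    [AddCommGroup W₁] [Module ℂ W₁] {r : ℕ}
    (a₁ a₂ : W₁ →ₗ[ℂ] W₀) (d : W₀ →ₗ[ℂ] W₁) (b : (Fin r → ℂ) →ₗ[ℂ] W₀)
    (x₁ x₂ x₃ y₁ y₂ : ℂ) :
    (W₀ × W₁ × W₀ × W₁ × (Fin r → ℂ)) →ₗ[ℂ] (W₀ × W₁) :=
  let p1 : (W₀ × W₁ × W₀ × W₁ × (Fin r → ℂ)) →ₗ[ℂ] W₀ :=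
    LinearMap.fst ℂ W₀ (W₁ × W₀ × W₁ × (Fin r → ℂ))
  let p2 : (W₀ × W₁ × W₀ × W₁ × (Fin r → ℂ)) →ₗ[ℂ] W₁ :=
    (LinearMap.fst ℂ W₁ (W₀ × W₁ × (Fin r → ℂ))).comp
      (LinearMap.snd ℂ W₀ (W₁ × W₀ × W₁ × (Fin r → ℂ)))
  let p3 : (W₀ × W₁ × W₀ × W₁ × (Fin r → ℂ)) →ₗ[ℂ] W₀ :=
    (LinearMap.fst ℂ W₀ (W₁ × (Fin r → ℂ))).comp
      ((LinearMap.snd ℂ W₁ (W₀ × W₁ × (Fin r → ℂ))).comp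
        (LinearMap.snd ℂ W₀ (W₁ × W₀ × W₁ × (Fin r → ℂ))))
  let p4 : (W₀ × W₁ × W₀ × W₁ × (Fin r → ℂ)) →ₗ[ℂ] W₁ :=
    (LinearMap.fst ℂ W₁ (Fin r → ℂ)).comp
      ((LinearMap.snd ℂ W₀ (W₁ × (Fin r → ℂ))).comp
        ((LinearMap.snd ℂ W₁ (W₀ × W₁ × (Fin r → ℂ))).comp
          (LinearMap.snd ℂ W₀ (W₁ × W₀ × W₁ × (Fin r → ℂ)))))
  let p5 : (W₀ × W₁ × W₀ × W₁ × (Fin r → ℂ)) →ₗ[ℂ] (Fin r → ℂ) :=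
    (LinearMap.snd ℂ W₁ (Fin r → ℂ)).comp
      ((LinearMap.snd ℂ W₀ (W₁ × (Fin r → ℂ))).comp
        ((LinearMap.snd ℂ W₁ (W₀ × W₁ × (Fin r → ℂ))).comp
          (LinearMap.snd ℂ W₀ (W₁ × W₀ × W₁ × (Fin r → ℂ)))))
  LinearMap.prod
    (x₂ • p1 + (x₃ • a₂).comp p2 - x₁ • p3 - (x₃ • a₁).comp p4 + (x₃ • b).comp p5)
    ((y₁ • d).comp p1 + y₁ • p2 + (y₂ • d).comp p3 + y₂ • p4)

/-- For a blow-up monad configuration `m̃ = (a₁,a₂,d,b,c)` and scalars with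
`x₁y₁ + x₂y₂ = 0`, the composition `B_m̃ ∘ A_m̃ : W₁ ⊕ W₀ → W₀ ⊕ W₁` is zero. -/
theorem blowup_monad_comp_eq_zero
    {W₀ W₁ : Type*} [AddCommGroup W₀] [Module ℂ W₀] [AddCommGroup W₁] [Module ℂ W₁]
    [FiniteDimensional ℂ W₀] [FiniteDimensional ℂ W₁]
    {r : ℕ} (hr : 1 ≤ r)
    (a₁ a₂ : W₁ →ₗ[ℂ] W₀) (d : W₀ →ₗ[ℂ] W₁)
    (b : (Fin r → ℂ) →ₗ[ℂ] W₀) (c : W₁ →ₗ[ℂ] (Fin r → ℂ))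
    (hint : a₁ ∘ₗ d ∘ₗ a₂ - a₂ ∘ₗ d ∘ₗ a₁ + b ∘ₗ c = 0)
    (x₁ x₂ x₃ y₁ y₂ : ℂ) (hxy : x₁ * y₁ + x₂ * y₂ = 0) :
    (blowupB a₁ a₂ d b x₁ x₂ x₃ y₁ y₂) ∘ₗ (blowupA a₁ a₂ d c x₁ x₂ x₃ y₁ y₂) = 0 := by
  have hpt (ξ : W₁) : a₁ (d (a₂ ξ)) - a₂ (d (a₁ ξ)) + b (c ξ) = 0 :=
    LinearMap.congr_fun hint ξ
  refine LinearMap.ext fun ⟨ξ₁, ξ₀⟩ => Prod.ext ?_ ?_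
  · simp only [blowupA, blowupB, LinearMap.comp_apply, LinearMap.prod_apply, Function.prod,
      LinearMap.add_apply, LinearMap.sub_apply, LinearMap.smul_apply, LinearMap.fst_apply,
      LinearMap.snd_apply, LinearMap.id_apply, LinearMap.zero_apply, Prod.fst_zero,
      map_add, map_sub, map_smul]
    linear_combination (norm := module) (x₃ ^ 2) • hpt ξ₁ - hxy • ξ₀
  · simp only [blowupA, blowupB, LinearMap.comp_apply, LinearMap.prod_apply, Function.prod,
      LinearMap.add_apply, LinearMap.sub_apply, LinearMap.smul_apply, LinearMap.fst_apply,
      LinearMap.snd_apply, LinearMap.id_apply, LinearMap.zero_apply, Prod.snd_zero,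
      map_add, map_sub, map_smul]
    linear_combination (norm := module) hxy • ξ₁
end

section
/- Let m = (a₁, a₂, b, c) be an ADHM configuration. Say m is non-degenerate if for every (x₁,x₂,x₃) ∈ ℂ³ ∖ {0} the map A_m(x₁,x₂,x₃) is injective and the map B_m(x₁,x₂,x₃) is surjective. Then m is non-degenerate if and only if the only b-special subspace of W is W itself and the only c-special subspace of W is {0}. -/
/-- The monad map `A_m(x₁,x₂,x₃) : W → W ⊕ W ⊕ ℂʳ` of an ADHM configuration. -/
noncomputable def adhmA {W : Type*} [AddCommGroup W] [Module ℂ W] {r : ℕ}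
    (a₁ a₂ : W →ₗ[ℂ] W) (c : W →ₗ[ℂ] (Fin r → ℂ)) (x₁ x₂ x₃ : ℂ) :
    W →ₗ[ℂ] W × W × (Fin r → ℂ) :=
  LinearMap.prod (x₁ • LinearMap.id - x₃ • a₁)
    (LinearMap.prod (x₂ • LinearMap.id - x₃ • a₂) (x₃ • c))

/-- The monad map `B_m(x₁,x₂,x₃) : W ⊕ W ⊕ ℂʳ → W` of an ADHM configuration. -/
noncomputable def adhmB {W : Type*} [AddCommGroup W] [Module ℂ W] {r : ℕ}
    (a₁ a₂ : W →ₗ[ℂ] W) (b : (Fin r → ℂ) →ₗ[ℂ] W) (x₁ x₂ x₃ : ℂ) :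
    (W × W × (Fin r → ℂ)) →ₗ[ℂ] W :=
  (x₃ • a₂ - x₂ • LinearMap.id).comp (LinearMap.fst ℂ W (W × (Fin r → ℂ)))
    + (x₁ • LinearMap.id - x₃ • a₁).comp
        ((LinearMap.fst ℂ W (Fin r → ℂ)).comp (LinearMap.snd ℂ W (W × (Fin r → ℂ))))
    + (x₃ • b).comp
        ((LinearMap.snd ℂ W (Fin r → ℂ)).comp (LinearMap.snd ℂ W (W × (Fin r → ℂ))))

/-- A subspace `V ⊆ W` is `b`-special: invariant under `a₁, a₂` and containing the
range of `b`. -/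
def IsBSpecial {W : Type*} [AddCommGroup W] [Module ℂ W] {r : ℕ}
    (a₁ a₂ : W →ₗ[ℂ] W) (b : (Fin r → ℂ) →ₗ[ℂ] W) (V : Submodule ℂ W) : Prop :=
  (∀ w ∈ V, a₁ w ∈ V) ∧ (∀ w ∈ V, a₂ w ∈ V) ∧ LinearMap.range b ≤ V

/-- A subspace `V ⊆ W` is `c`-special: invariant under `a₁, a₂` and contained in the
kernel of `c`. -/
def IsCSpecial {W : Type*} [AddCommGroup W] [Module ℂ W] {r : ℕ}
    (a₁ a₂ : W →ₗ[ℂ] W) (c : W →ₗ[ℂ] (Fin r → ℂ)) (V : Submodule ℂ W) : Prop :=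
  (∀ w ∈ V, a₁ w ∈ V) ∧ (∀ w ∈ V, a₂ w ∈ V) ∧ V ≤ LinearMap.ker c

/-- A nonzero invariant subspace of an endomorphism contains an eigenvector. -/
theorem exists_eigenvector_mem_of_invariant {E : Type*} [AddCommGroup E] [Module ℂ E]
    [FiniteDimensional ℂ E] (f : E →ₗ[ℂ] E) (V : Submodule ℂ E) (hV : V ≠ ⊥)
    (hf : ∀ w ∈ V, f w ∈ V) : ∃ μ : ℂ, ∃ v ∈ V, v ≠ 0 ∧ f v = μ • v := by
  have : Nontrivial V := Submodule.nontrivial_iff_ne_bot.mpr hV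
  obtain ⟨μ, hμ⟩ := Module.End.exists_eigenvalue (f.restrict hf)
  obtain ⟨v, hv⟩ := hμ.exists_hasEigenvector
  exact ⟨μ, v, v.2, fun h => hv.2 (Subtype.ext h), congrArg Subtype.val hv.apply_eq_smul⟩

/-- Two endomorphisms that preserve a nonzero subspace and commute on it have a common
eigenvector in it. -/
theorem exists_common_eigenvector_mem {E : Type*} [AddCommGroup E] [Module ℂ E]
    [FiniteDimensional ℂ E] (f g : E →ₗ[ℂ] E) (V : Submodule ℂ E) (hV : V ≠ ⊥)
    (hf : ∀ w ∈ V, f w ∈ V) (hg : ∀ w ∈ V, g w ∈ V) (hfg : ∀ w ∈ V, f (g w) = g (f w)) :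
    ∃ μ ν : ℂ, ∃ v ∈ V, v ≠ 0 ∧ f v = μ • v ∧ g v = ν • v := by
  obtain ⟨μ, v, hvV, hv0, hv⟩ := exists_eigenvector_mem_of_invariant f V hV hf
  obtain ⟨ν, u, hu, hu0, hgu⟩ :=
    exists_eigenvector_mem_of_invariant g (V ⊓ Module.End.eigenspace f μ)
      (Submodule.ne_bot_iff _ |>.mpr ⟨v, ⟨hvV, Module.End.mem_eigenspace_iff.mpr hv⟩, hv0⟩)
      (fun w hw => ⟨hg w hw.1, Module.End.mem_eigenspace_iff.mpr (by
        rw [hfg w hw.1, Module.End.mem_eigenspace_iff.mp hw.2, map_smul])⟩)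
  exact ⟨μ, ν, u, hu.1, hu0, Module.End.mem_eigenspace_iff.mp hu.2, hgu⟩

section ADHM

variable {W : Type*} [AddCommGroup W] [Module ℂ W] {r : ℕ}

@[simp]
theorem adhmA_apply (a₁ a₂ : W →ₗ[ℂ] W) (c : W →ₗ[ℂ] (Fin r → ℂ)) (x₁ x₂ x₃ : ℂ) (w : W) :
    adhmA a₁ a₂ c x₁ x₂ x₃ w = (x₁ • w - x₃ • a₁ w, x₂ • w - x₃ • a₂ w, x₃ • c w) := rfl

@[simp]
theorem adhmB_apply (a₁ a₂ : W →ₗ[ℂ] W) (b : (Fin r → ℂ) →ₗ[ℂ] W) (x₁ x₂ x₃ : ℂ)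
    (p : W × W × (Fin r → ℂ)) :
    adhmB a₁ a₂ b x₁ x₂ x₃ p =
      (x₃ • a₂ p.1 - x₂ • p.1) + (x₁ • p.2.1 - x₃ • a₁ p.2.1) + x₃ • b p.2.2 := rfl

theorem adhmA_injective_of_cSpecial {a₁ a₂ : W →ₗ[ℂ] W} {c : W →ₗ[ℂ] (Fin r → ℂ)}
    (h : ∀ V : Submodule ℂ W, IsCSpecial a₁ a₂ c V → V = ⊥) {x₁ x₂ x₃ : ℂ}
    (hx : (x₁, x₂, x₃) ≠ (0, 0, 0)) : Function.Injective (adhmA a₁ a₂ c x₁ x₂ x₃) := by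
  rw [injective_iff_map_eq_zero]
  intro w hw
  simp only [adhmA_apply, Prod.mk_eq_zero] at hw
  obtain ⟨h₁, h₂, h₃⟩ := hw
  by_cases hx₃ : x₃ = 0
  · subst hx₃
    simp only [zero_smul, sub_zero, smul_eq_zero] at h₁ h₂
    by_contra hw0
    exact hx (by simp [h₁.resolve_right hw0, h₂.resolve_right hw0])
  · have eig : ∀ {x : ℂ} {a : W →ₗ[ℂ] W}, x • w - x₃ • a w = 0 → a w = (x₃⁻¹ * x) • w := by
      intro x a ha
      rw [mul_smul, sub_eq_zero.mp ha, inv_smul_smul₀ hx₃]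
    have inv : ∀ {x : ℂ} {a : W →ₗ[ℂ] W}, x • w - x₃ • a w = 0 →
        ∀ v ∈ Submodule.span ℂ {w}, a v ∈ Submodule.span ℂ {w} := by
      intro x a ha v hv
      obtain ⟨t, rfl⟩ := Submodule.mem_span_singleton.mp hv
      rw [map_smul, eig ha]
      exact Submodule.smul_mem _ _ (Submodule.smul_mem _ _ (Submodule.mem_span_singleton_self w))
    refine Submodule.span_singleton_eq_bot.mp (h _ ⟨inv h₁, inv h₂, ?_⟩)
    rw [Submodule.span_singleton_le_iff_mem]
    exact (smul_eq_zero.mp h₃).resolve_left hx₃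

theorem adhmB_surjective_of_bSpecial {a₁ a₂ : W →ₗ[ℂ] W} {b : (Fin r → ℂ) →ₗ[ℂ] W}
    (h : ∀ V : Submodule ℂ W, IsBSpecial a₁ a₂ b V → V = ⊤) {x₁ x₂ x₃ : ℂ}
    (hx : (x₁, x₂, x₃) ≠ (0, 0, 0)) : Function.Surjective (adhmB a₁ a₂ b x₁ x₂ x₃) := by
  have m₁ : ∀ v, x₁ • v - x₃ • a₁ v ∈ LinearMap.range (adhmB a₁ a₂ b x₁ x₂ x₃) :=
    fun v => ⟨(0, v, 0), by simp⟩
  have m₂ : ∀ v, x₂ • v - x₃ • a₂ v ∈ LinearMap.range (adhmB a₁ a₂ b x₁ x₂ x₃) :=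
    fun v => ⟨(-v, 0, 0), by simp [sub_eq_add_neg, add_comm]⟩
  have m₃ : ∀ u, x₃ • b u ∈ LinearMap.range (adhmB a₁ a₂ b x₁ x₂ x₃) :=
    fun u => ⟨(0, 0, u), by simp⟩
  rw [← LinearMap.range_eq_top]
  generalize LinearMap.range (adhmB a₁ a₂ b x₁ x₂ x₃) = V at m₁ m₂ m₃
  by_cases hx₃ : x₃ = 0
  · subst hx₃
    simp only [zero_smul, sub_zero] at m₁ m₂
    refine Submodule.eq_top_iff'.mpr fun v => ?_
    by_cases hx₁ : x₁ = 0
    · have hx₂ : x₂ ≠ 0 := fun hx₂ => hx (by simp [hx₁, hx₂])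
      exact (V.smul_mem_iff hx₂).mp (m₂ v)
    · exact (V.smul_mem_iff hx₁).mp (m₁ v)
  · refine h _ ⟨fun w hw => ?_, fun w hw => ?_, ?_⟩
    · exact (V.smul_mem_iff hx₃).mp ((V.sub_mem_iff_right (V.smul_mem x₁ hw)).mp (m₁ w))
    · exact (V.smul_mem_iff hx₃).mp ((V.sub_mem_iff_right (V.smul_mem x₂ hw)).mp (m₂ w))
    · rintro _ ⟨u, rfl⟩
      exact (V.smul_mem_iff hx₃).mp (m₃ u)

theorem IsCSpecial.eq_bot [FiniteDimensional ℂ W] {a₁ a₂ : W →ₗ[ℂ] W}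
    {b : (Fin r → ℂ) →ₗ[ℂ] W} {c : W →ₗ[ℂ] (Fin r → ℂ)}
    (hint : a₁ ∘ₗ a₂ - a₂ ∘ₗ a₁ + b ∘ₗ c = 0)
    (hA : ∀ x₁ x₂ : ℂ, Function.Injective (adhmA a₁ a₂ c x₁ x₂ 1))
    {V : Submodule ℂ W} (hV : IsCSpecial a₁ a₂ c V) : V = ⊥ := by
  obtain ⟨h₁, h₂, hc⟩ := hV
  have hc0 : ∀ w ∈ V, c w = 0 := fun w hw => hc hw
  by_contra hne
  obtain ⟨μ, ν, v, hv, hv0, e₁, e₂⟩ := exists_common_eigenvector_mem a₁ a₂ V hne h₁ h₂ (by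
    intro w hw
    have hw' := LinearMap.congr_fun hint w
    simp only [LinearMap.add_apply, LinearMap.sub_apply, LinearMap.comp_apply, hc0 w hw,
      map_zero, add_zero, LinearMap.zero_apply] at hw'
    exact sub_eq_zero.mp hw')
  exact hv0 (hA μ ν (by simp [e₁, e₂, hc0 v hv]))

theorem IsBSpecial.eq_top [FiniteDimensional ℂ W] {a₁ a₂ : W →ₗ[ℂ] W}
    {b : (Fin r → ℂ) →ₗ[ℂ] W} {c : W →ₗ[ℂ] (Fin r → ℂ)}
    (hint : a₁ ∘ₗ a₂ - a₂ ∘ₗ a₁ + b ∘ₗ c = 0)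
    (hB : ∀ x₁ x₂ : ℂ, Function.Surjective (adhmB a₁ a₂ b x₁ x₂ 1))
    {V : Submodule ℂ W} (hV : IsBSpecial a₁ a₂ b V) : V = ⊤ := by
  obtain ⟨h₁, h₂, hb⟩ := hV
  have hb0 : ∀ φ ∈ V.dualAnnihilator, ∀ u, φ (b u) = 0 := fun φ hφ u =>
    (Submodule.mem_dualAnnihilator φ).mp hφ _ (hb ⟨u, rfl⟩)
  have inv : ∀ {a : W →ₗ[ℂ] W}, (∀ w ∈ V, a w ∈ V) →
      ∀ φ ∈ V.dualAnnihilator, a.dualMap φ ∈ V.dualAnnihilator := fun ha φ hφ =>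
    (Submodule.mem_dualAnnihilator _).mpr fun w hw =>
      (Submodule.mem_dualAnnihilator φ).mp hφ _ (ha w hw)
  by_contra hne
  obtain ⟨μ, ν, φ, hφ, hφ0, e₁, e₂⟩ := exists_common_eigenvector_mem a₁.dualMap a₂.dualMap
    V.dualAnnihilator (fun h => hne (Subspace.dualAnnihilator_inj.mp
      (h.trans Submodule.dualAnnihilator_top.symm))) (inv h₁) (inv h₂) (by
    intro φ hφ
    ext w
    have hw := congrArg φ (LinearMap.congr_fun hint w)
    simp only [LinearMap.add_apply, LinearMap.sub_apply, LinearMap.comp_apply, map_add, map_sub,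
      hb0 φ hφ, map_zero, add_zero, LinearMap.zero_apply] at hw
    exact (sub_eq_zero.mp hw).symm)
  refine hφ0 (LinearMap.ext fun w => ?_)
  obtain ⟨p, rfl⟩ := hB μ ν w
  have f₁ : φ (a₁ p.2.1) = μ • φ p.2.1 := LinearMap.congr_fun e₁ _
  have f₂ : φ (a₂ p.1) = ν • φ p.1 := LinearMap.congr_fun e₂ _
  simp [f₁, f₂, hb0 φ hφ]

end ADHM

/-- An ADHM configuration is non-degenerate (i.e. `A_m` injective and `B_m`
surjective at every nonzero `(x₁,x₂,x₃) ∈ ℂ³`) iff the only `b`-special subspace is `W`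
and the only `c`-special subspace is `0`. -/
theorem adhm_nondegenerate_iff_special
    {W : Type*} [AddCommGroup W] [Module ℂ W] [FiniteDimensional ℂ W]
    {r : ℕ} (hr : 1 ≤ r)
    (a₁ a₂ : W →ₗ[ℂ] W) (b : (Fin r → ℂ) →ₗ[ℂ] W) (c : W →ₗ[ℂ] (Fin r → ℂ))
    (hint : a₁ ∘ₗ a₂ - a₂ ∘ₗ a₁ + b ∘ₗ c = 0) :
    (∀ x₁ x₂ x₃ : ℂ, (x₁, x₂, x₃) ≠ (0, 0, 0) →
        Function.Injective (adhmA a₁ a₂ c x₁ x₂ x₃)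
          ∧ Function.Surjective (adhmB a₁ a₂ b x₁ x₂ x₃)) ↔
      ((∀ V : Submodule ℂ W, IsBSpecial a₁ a₂ b V → V = ⊤)
        ∧ (∀ V : Submodule ℂ W, IsCSpecial a₁ a₂ c V → V = ⊥)) := by
  constructor
  · intro h
    have hne : ∀ x₁ x₂ : ℂ, (x₁, x₂, (1 : ℂ)) ≠ (0, 0, 0) := by simp
    exact ⟨fun V hV => hV.eq_top hint fun x₁ x₂ => (h x₁ x₂ 1 (hne x₁ x₂)).2,
      fun V hV => hV.eq_bot hint fun x₁ x₂ => (h x₁ x₂ 1 (hne x₁ x₂)).1⟩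
  · rintro ⟨hB, hC⟩ x₁ x₂ x₃ hx
    exact ⟨adhmA_injective_of_cSpecial hC hx, adhmB_surjective_of_bSpecial hB hx⟩
end

section
/- Let m = (a₁, a₂, b, c) be an ADHM configuration with a₁ and a₂ nilpotent, and suppose c ∘ a₁^{n₁} ∘ a₂^{n₂} ∘ b = 0 for all integers n₁, n₂ ≥ 0. Let α₂, α₃ ∈ ℂ with α₂ ≠ 0, let e ∈ ℂʳ, and set ξ₁ = α₃(1 − α₃a₁)⁻¹(α₂ − α₃a₂)⁻¹(b e) ∈ W. Define 𝔄₁ : W ⊕ ℂʳ → W ⊕ W ⊕ ℂʳ by 𝔄₁(ξ, u) = ((1 − α₃a₁)ξ, (α₂ − α₃a₂)ξ − α₃(1 − α₃a₁)⁻¹(b u), α₃·c(ξ) + u). Then 𝔄₁(ξ₁, e) = (α₃(α₂ − α₃a₂)⁻¹(b e), 0, e). In particular (α₂ − α₃a₂)ξ₁ = α₃(1 − α₃a₁)⁻¹(b e) and c(ξ₁) = 0. -/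
/-- The map `𝔄₁ : W ⊕ ℂʳ → W ⊕ W ⊕ ℂʳ`,
`(ξ, u) ↦ ((1 − α₃a₁)ξ, (α₂ − α₃a₂)ξ − α₃(1 − α₃a₁)⁻¹(b u), α₃·c(ξ) + u)`. -/
noncomputable def frakA1 {W : Type*} [AddCommGroup W] [Module ℂ W] {r : ℕ}
    (a₁ a₂ : Module.End ℂ W) (b : (Fin r → ℂ) →ₗ[ℂ] W) (c : W →ₗ[ℂ] (Fin r → ℂ))
    (α₂ α₃ : ℂ) :
    (W × (Fin r → ℂ)) →ₗ[ℂ] (W × W × (Fin r → ℂ)) :=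
  LinearMap.prod
    (((1 : Module.End ℂ W) - α₃ • a₁) ∘ₗ LinearMap.fst ℂ W (Fin r → ℂ))
    (LinearMap.prod
      ((α₂ • (1 : Module.End ℂ W) - α₃ • a₂) ∘ₗ LinearMap.fst ℂ W (Fin r → ℂ)
        - (α₃ • (Ring.inverse ((1 : Module.End ℂ W) - α₃ • a₁) ∘ₗ b))
            ∘ₗ LinearMap.snd ℂ W (Fin r → ℂ))
      ((α₃ • c) ∘ₗ LinearMap.fst ℂ W (Fin r → ℂ) + LinearMap.snd ℂ W (Fin r → ℂ)))

/-- In finite dimension, the inverse of an invertible operator preserves every invariant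
subspace. -/
theorem Module.End.ringInverse_apply_mem {K W : Type*} [Field K] [AddCommGroup W] [Module K W]
    [FiniteDimensional K W] {f : Module.End K W} (hf : IsUnit f) {V : Submodule K W}
    (hV : ∀ x ∈ V, f x ∈ V) {x : W} (hx : x ∈ V) : Ring.inverse f x ∈ V := by
  have hinj : Function.Injective f := ((Module.End.isUnit_iff f).1 hf).1
  have hres : Function.Injective (f.restrict hV) := fun y z h =>
    Subtype.ext (hinj (congrArg Subtype.val h))
  obtain ⟨y, hy⟩ := LinearMap.injective_iff_surjective.1 hres ⟨x, hx⟩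
  have hyx : f y = x := congrArg Subtype.val hy
  have hinv : Ring.inverse f (f y) = y :=
    LinearMap.congr_fun (Ring.inverse_mul_cancel f hf) (y : W)
  rw [← hyx, hinv]
  exact y.2

/-- If `c ∘ a₁^i ∘ a₂^j ∘ b = 0` for all `i, j`, then `a₂` passes through powers of `a₁` on
the vectors `a₁^i a₂^j (b u)`. -/
theorem adhm_apply_pow_mul_pow {K W U : Type*} [Field K] [AddCommGroup W] [Module K W]
    [AddCommGroup U] [Module K U] {a₁ a₂ : Module.End K W} {b : U →ₗ[K] W} {c : W →ₗ[K] U}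
    (hint : a₁ * a₂ - a₂ * a₁ + b ∘ₗ c = 0)
    (hc : ∀ i j : ℕ, c ∘ₗ (a₁ ^ i * a₂ ^ j) ∘ₗ b = 0) (i j : ℕ) (u : U) :
    a₂ ((a₁ ^ i * a₂ ^ j) (b u)) = (a₁ ^ i * a₂ ^ (j + 1)) (b u) := by
  induction i with
  | zero => simp [pow_succ']
  | succ i ih =>
    have hcx : c ((a₁ ^ i * a₂ ^ j) (b u)) = 0 := LinearMap.congr_fun (hc i j) u
    have hx := LinearMap.congr_fun hint ((a₁ ^ i * a₂ ^ j) (b u))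
    simp only [LinearMap.add_apply, LinearMap.sub_apply, Module.End.mul_apply,
      LinearMap.comp_apply, LinearMap.zero_apply] at hx hcx ih ⊢
    rw [hcx, map_zero, add_zero, sub_eq_zero] at hx
    rw [pow_succ', Module.End.mul_apply, Module.End.mul_apply, ← hx, ih]

/-- If `c ∘ a₁^i ∘ a₂^j ∘ b = 0` for all `i, j`, then the image of `b` lies in a subspace of
`ker c` invariant under `a₁` and `a₂`. -/
theorem adhm_exists_invariant_le_ker {K W U : Type*} [Field K] [AddCommGroup W] [Module K W]
    [AddCommGroup U] [Module K U] {a₁ a₂ : Module.End K W} {b : U →ₗ[K] W} {c : W →ₗ[K] U}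
    (hint : a₁ * a₂ - a₂ * a₁ + b ∘ₗ c = 0)
    (hc : ∀ i j : ℕ, c ∘ₗ (a₁ ^ i * a₂ ^ j) ∘ₗ b = 0) :
    ∃ V : Submodule K W, (∀ u, b u ∈ V) ∧ (∀ x ∈ V, a₁ x ∈ V) ∧ (∀ x ∈ V, a₂ x ∈ V) ∧
      ∀ x ∈ V, c x = 0 := by
  let s : Set W := {x | ∃ (i j : ℕ) (u : U), (a₁ ^ i * a₂ ^ j) (b u) = x}
  have hs (i j : ℕ) (u : U) : (a₁ ^ i * a₂ ^ j) (b u) ∈ Submodule.span K s :=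
    Submodule.subset_span ⟨i, j, u, rfl⟩
  have h₁ : Submodule.span K s ≤ (Submodule.span K s).comap a₁ := by
    refine Submodule.span_le.2 ?_
    rintro _ ⟨i, j, u, rfl⟩
    have h := hs (i + 1) j u
    rwa [pow_succ', mul_assoc, Module.End.mul_apply] at h
  have h₂ : Submodule.span K s ≤ (Submodule.span K s).comap a₂ := by
    refine Submodule.span_le.2 ?_
    rintro _ ⟨i, j, u, rfl⟩
    have h := hs i (j + 1) u
    rwa [← adhm_apply_pow_mul_pow hint hc] at h
  have h₃ : Submodule.span K s ≤ LinearMap.ker c := by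
    refine Submodule.span_le.2 ?_
    rintro _ ⟨i, j, u, rfl⟩
    exact LinearMap.congr_fun (hc i j) u
  exact ⟨Submodule.span K s, fun u => by simpa using hs 0 0 u, h₁, h₂, h₃⟩

/-- For an ADHM configuration `(a₁,a₂,b,c)` with `a₁, a₂` nilpotent and
`c ∘ a₁^{n₁} ∘ a₂^{n₂} ∘ b = 0` for all `n₁, n₂ ≥ 0`, `α₂ ≠ 0`, and
`ξ₁ = α₃(1 − α₃a₁)⁻¹(α₂ − α₃a₂)⁻¹(b e)`, one has
`𝔄₁(ξ₁, e) = (α₃(α₂ − α₃a₂)⁻¹(b e), 0, e)`; in particular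
`(α₂ − α₃a₂)ξ₁ = α₃(1 − α₃a₁)⁻¹(b e)` and `c(ξ₁) = 0`. -/
theorem frakA1_glueing_identity
    {W : Type*} [AddCommGroup W] [Module ℂ W] [FiniteDimensional ℂ W]
    {r : ℕ} (hr : 1 ≤ r)
    (a₁ a₂ : Module.End ℂ W) (b : (Fin r → ℂ) →ₗ[ℂ] W) (c : W →ₗ[ℂ] (Fin r → ℂ))
    (hint : a₁ * a₂ - a₂ * a₁ + b ∘ₗ c = 0)
    (hn₁ : IsNilpotent a₁) (hn₂ : IsNilpotent a₂)
    (hc : ∀ n₁ n₂ : ℕ, c ∘ₗ (a₁ ^ n₁ * a₂ ^ n₂) ∘ₗ b = 0)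
    (α₂ α₃ : ℂ) (hα₂ : α₂ ≠ 0) (e : Fin r → ℂ)
    (ξ₁ : W)
    (hξ₁ : ξ₁ = α₃ • (Ring.inverse ((1 : Module.End ℂ W) - α₃ • a₁))
        ((Ring.inverse (α₂ • (1 : Module.End ℂ W) - α₃ • a₂)) (b e))) :
    frakA1 a₁ a₂ b c α₂ α₃ (ξ₁, e)
        = (α₃ • (Ring.inverse (α₂ • (1 : Module.End ℂ W) - α₃ • a₂)) (b e), 0, e)
      ∧ (α₂ • (1 : Module.End ℂ W) - α₃ • a₂) ξ₁
          = α₃ • (Ring.inverse ((1 : Module.End ℂ W) - α₃ • a₁)) (b e)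
      ∧ c ξ₁ = 0 := by
  obtain ⟨V, hbV, h₁V, h₂V, hcV⟩ := adhm_exists_invariant_le_ker hint hc
  set A : Module.End ℂ W := 1 - α₃ • a₁ with hA
  set B : Module.End ℂ W := α₂ • 1 - α₃ • a₂ with hB
  have hAu : IsUnit A := (hn₁.smul α₃).isUnit_one_sub
  have hBu : IsUnit B := by
    have h : IsUnit (α₂ • (1 : Module.End ℂ W)) := by
      simpa [Algebra.algebraMap_eq_smul_one] using
        (IsUnit.mk0 α₂ hα₂).map (algebraMap ℂ (Module.End ℂ W))
    have hcomm : Commute (α₃ • a₂) (α₂ • (1 : Module.End ℂ W)) :=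
      ((Commute.one_right a₂).smul_left α₃).smul_right α₂
    rw [hB, ← neg_sub, IsUnit.neg_iff, sub_eq_add_neg]
    exact (hn₂.smul α₃).isUnit_add_right_of_commute h.neg hcomm.neg_right
  have hAV : ∀ x ∈ V, A x ∈ V := fun x hx =>
    V.sub_mem hx (V.smul_mem α₃ (h₁V x hx))
  have hBV : ∀ x ∈ V, B x ∈ V := fun x hx =>
    V.sub_mem (V.smul_mem α₂ hx) (V.smul_mem α₃ (h₂V x hx))
  have hA_inv (x : W) : A (Ring.inverse A x) = x :=
    LinearMap.congr_fun (Ring.mul_inverse_cancel A hAu) x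
  have hA_inv' (x : W) : Ring.inverse A (A x) = x :=
    LinearMap.congr_fun (Ring.inverse_mul_cancel A hAu) x
  have hB_inv (x : W) : B (Ring.inverse B x) = x :=
    LinearMap.congr_fun (Ring.mul_inverse_cancel B hBu) x
  have hξV : ξ₁ ∈ V := hξ₁ ▸ V.smul_mem α₃ (Module.End.ringInverse_apply_mem hAu hAV
    (Module.End.ringInverse_apply_mem hBu hBV (hbV e)))
  have hcξ : c ξ₁ = 0 := hcV ξ₁ hξV
  have hAξ : A ξ₁ = α₃ • Ring.inverse B (b e) := by rw [hξ₁, map_smul, hA_inv]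
  have hcomm : A (B ξ₁) = B (A ξ₁) := by
    have h := LinearMap.congr_fun hint ξ₁
    simp only [LinearMap.add_apply, LinearMap.sub_apply, Module.End.mul_apply,
      LinearMap.comp_apply, LinearMap.zero_apply, hcξ, map_zero, add_zero, sub_eq_zero] at h
    simp only [hA, hB, LinearMap.sub_apply, LinearMap.smul_apply, Module.End.one_apply,
      map_sub, map_smul, h]
    module
  have hBξ : B ξ₁ = α₃ • Ring.inverse A (b e) := by
    rw [← hA_inv' (B ξ₁), hcomm, hAξ, map_smul, hB_inv, map_smul]
  refine ⟨?_, hBξ, hcξ⟩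
  simp [frakA1, ← hA, ← hB, hAξ, hBξ, hcξ]
end

section
/- Let W be a finite-dimensional complex vector space, r ≥ 1, and let m = (a₁, a₂, b, c) with a₁, a₂ ∈ End(W), b ∈ Hom(ℂʳ, W), c ∈ Hom(W, ℂʳ) satisfy a₁∘a₂ − a₂∘a₁ + b∘c = 0. Suppose that the closure of the GL(W)-orbit of m, i.e. the closure of the set {(g⁻¹∘a₁∘g, g⁻¹∘a₂∘g, g⁻¹∘b, c∘g) : g ∈ GL(W)} in End(W) × End(W) × Hom(ℂʳ, W) × Hom(W, ℂʳ) (with its standard topology as a finite-dimensional complex vector space), contains the zero tuple (0, 0, 0, 0). Then a₁ and a₂ are nilpotent, and there exists a subspace V ⊆ W with a₁(V) ⊆ V, a₂(V) ⊆ V, range(b) ⊆ V, and V ⊆ ker(c). -/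
/-- An endomorphism of a finite-dimensional complex vector space is nilpotent if `0` is its only
eigenvalue. -/
theorem Module.End.isNilpotent_of_forall_hasEigenvalue_eq_zero
    {K V : Type*} [Field K] [IsAlgClosed K] [AddCommGroup V] [Module K V] [FiniteDimensional K V]
    (f : Module.End K V) (h : ∀ μ, f.HasEigenvalue μ → μ = 0) : IsNilpotent f := by
  have htop : f.maxGenEigenspace 0 = ⊤ := by
    rw [eq_top_iff, ← f.iSup_maxGenEigenspace_eq_top]
    refine iSup_le fun μ => ?_
    by_cases hμ : f.HasEigenvalue μ
    · rw [h μ hμ]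
    · have hbot : f.maxGenEigenspace μ = ⊥ := by
        rw [f.maxGenEigenspace_eq_genEigenspace_finrank]
        by_contra hne
        exact hμ (Module.End.hasEigenvalue_of_hasGenEigenvalue hne)
      rw [hbot]
      exact bot_le
  refine ⟨Module.finrank K V, LinearMap.ext fun x => ?_⟩
  have hx : x ∈ f.maxGenEigenspace 0 := htop ▸ Submodule.mem_top
  rw [f.maxGenEigenspace_eq_genEigenspace_finrank, Module.End.mem_genEigenspace_nat] at hx
  simpa using hx

/-- An eigenvalue of `a` is bounded by the norm of any conjugate of `a`. -/
theorem ContinuousLinearMap.norm_le_norm_conj_of_hasEigenvalue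
    {W : Type*} [NormedAddCommGroup W] [NormedSpace ℂ W] (a : W →L[ℂ] W) {μ : ℂ}
    (hμ : Module.End.HasEigenvalue (a : W →ₗ[ℂ] W) μ) (g : W ≃L[ℂ] W) :
    ‖μ‖ ≤ ‖(g.symm : W →L[ℂ] W).comp (a.comp (g : W →L[ℂ] W))‖ := by
  obtain ⟨v, hv⟩ := hμ.exists_hasEigenvector
  have hav : a v = μ • v := hv.apply_eq_smul
  have hpos : 0 < ‖g.symm v‖ := by simpa using hv.2
  have h := ((g.symm : W →L[ℂ] W).comp (a.comp (g : W →L[ℂ] W))).le_opNorm (g.symm v)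
  simp only [ContinuousLinearMap.comp_apply, ContinuousLinearEquiv.coe_coe,
    ContinuousLinearEquiv.apply_symm_apply, hav, map_smul, norm_smul] at h
  exact le_of_mul_le_mul_right h hpos

/-- An endomorphism is nilpotent if there are arbitrarily small conjugates of it. -/
theorem ContinuousLinearMap.isNilpotent_of_forall_exists_norm_conj_lt
    {W : Type*} [NormedAddCommGroup W] [NormedSpace ℂ W] [FiniteDimensional ℂ W] (a : W →L[ℂ] W)
    (h : ∀ ε > 0, ∃ g : W ≃L[ℂ] W,
      ‖(g.symm : W →L[ℂ] W).comp (a.comp (g : W →L[ℂ] W))‖ < ε) : IsNilpotent a := by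
  have hlin : IsNilpotent (a : W →ₗ[ℂ] W) := by
    refine Module.End.isNilpotent_of_forall_hasEigenvalue_eq_zero _ fun μ hμ => ?_
    by_contra hne
    obtain ⟨g, hg⟩ := h ‖μ‖ (norm_pos_iff.2 hne)
    exact absurd (a.norm_le_norm_conj_of_hasEigenvalue hμ g) (not_le.2 hg)
  obtain ⟨n, hn⟩ := hlin
  refine ⟨n, ContinuousLinearMap.coe_injective ?_⟩
  rw [ContinuousLinearMap.toLinearMap_pow, hn]
  rfl

/-- Evaluation of a word in two letters at a pair of elements of a monoid. -/
def wordEval {M : Type*} [Monoid M] (x y : M) (l : List Bool) : M :=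
  (l.map fun i => cond i x y).prod

@[simp]
theorem wordEval_nil {M : Type*} [Monoid M] (x y : M) : wordEval x y [] = 1 := rfl

@[simp]
theorem wordEval_cons {M : Type*} [Monoid M] (x y : M) (i : Bool) (l : List Bool) :
    wordEval x y (i :: l) = cond i x y * wordEval x y l := by
  simp [wordEval]

theorem continuous_wordEval {M : Type*} [Monoid M] [TopologicalSpace M] [ContinuousMul M]
    (l : List Bool) : Continuous fun p : M × M => wordEval p.1 p.2 l := by
  induction l with
  | nil => exact continuous_const
  | cons i l ih =>
    simp only [wordEval_cons]
    refine Continuous.mul ?_ ih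
    cases i
    · exact continuous_snd
    · exact continuous_fst

theorem wordEval_conj_apply {W : Type*} [NormedAddCommGroup W] [NormedSpace ℂ W]
    (x y : W →L[ℂ] W) (g : W ≃L[ℂ] W) (l : List Bool) (w : W) :
    wordEval ((g.symm : W →L[ℂ] W).comp (x.comp (g : W →L[ℂ] W)))
      ((g.symm : W →L[ℂ] W).comp (y.comp (g : W →L[ℂ] W))) l (g.symm w) =
    g.symm (wordEval x y l w) := by
  induction l with
  | nil => simp
  | cons i l ih => cases i <;> simp [ih]

/-- The smallest subspace invariant under `x` and `y` that contains the range of `b`, as the span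
of the images of `b` under all words in `x` and `y`. -/
def wordSpan {U W : Type*} [NormedAddCommGroup U] [NormedSpace ℂ U] [NormedAddCommGroup W]
    [NormedSpace ℂ W] (x y : W →L[ℂ] W) (b : U →L[ℂ] W) : Submodule ℂ W :=
  Submodule.span ℂ {w | ∃ l u, wordEval x y l (b u) = w}

section wordSpan

variable {U W : Type*} [NormedAddCommGroup U] [NormedSpace ℂ U] [NormedAddCommGroup W]
  [NormedSpace ℂ W] (x y : W →L[ℂ] W) (b : U →L[ℂ] W)

theorem apply_mem_wordSpan (u : U) : b u ∈ wordSpan x y b :=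
  Submodule.subset_span ⟨[], u, by simp⟩

theorem cond_apply_mem_wordSpan (i : Bool) {w : W} (hw : w ∈ wordSpan x y b) :
    (cond i x y) w ∈ wordSpan x y b := by
  have hle : wordSpan x y b ≤ (wordSpan x y b).comap (cond i x y : W →L[ℂ] W).toLinearMap := by
    refine Submodule.span_le.2 ?_
    rintro _ ⟨l, u, rfl⟩
    exact Submodule.subset_span ⟨i :: l, u, by simp⟩
  exact hle hw

theorem apply_eq_zero_of_mem_wordSpan {V : Type*} [NormedAddCommGroup V] [NormedSpace ℂ V]
    (c : W →L[ℂ] V) (h : ∀ l u, c (wordEval x y l (b u)) = 0) {w : W}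
    (hw : w ∈ wordSpan x y b) : c w = 0 := by
  have hle : wordSpan x y b ≤ LinearMap.ker c.toLinearMap := by
    refine Submodule.span_le.2 ?_
    rintro _ ⟨l, u, rfl⟩
    exact h l u
  exact hle hw

end wordSpan


/-- If the closure of the `GL(W)`-orbit of an ADHM configuration
`(a₁,a₂,b,c)` contains the zero tuple, then `a₁` and `a₂` are nilpotent and there is a
subspace `V ⊆ W` invariant under `a₁, a₂`, containing the range of `b` and contained in
the kernel of `c`. -/
theorem adhm_orbit_closure_zero_implies_special
    {W : Type*} [NormedAddCommGroup W] [NormedSpace ℂ W] [FiniteDimensional ℂ W]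
    {r : ℕ} (hr : 1 ≤ r)
    (a₁ a₂ : W →L[ℂ] W) (b : (Fin r → ℂ) →L[ℂ] W) (c : W →L[ℂ] (Fin r → ℂ))
    (hint : a₁.comp a₂ - a₂.comp a₁ + b.comp c = 0)
    (h0 : ((0, 0, 0, 0) :
        (W →L[ℂ] W) × (W →L[ℂ] W) × ((Fin r → ℂ) →L[ℂ] W) × (W →L[ℂ] (Fin r → ℂ)))
      ∈ closure {x : (W →L[ℂ] W) × (W →L[ℂ] W) × ((Fin r → ℂ) →L[ℂ] W) ×
            (W →L[ℂ] (Fin r → ℂ)) |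
          ∃ g : W ≃L[ℂ] W,
            x = ((g.symm : W →L[ℂ] W).comp (a₁.comp (g : W →L[ℂ] W)),
                 (g.symm : W →L[ℂ] W).comp (a₂.comp (g : W →L[ℂ] W)),
                 (g.symm : W →L[ℂ] W).comp b,
                 c.comp (g : W →L[ℂ] W))}) :
    IsNilpotent a₁ ∧ IsNilpotent a₂
      ∧ ∃ V : Submodule ℂ W,
          (∀ w ∈ V, a₁ w ∈ V) ∧ (∀ w ∈ V, a₂ w ∈ V)
            ∧ (∀ u : Fin r → ℂ, b u ∈ V) ∧ (∀ w ∈ V, c w = 0) := by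
  have small : ∀ ε > 0, ∃ g : W ≃L[ℂ] W,
      ‖(g.symm : W →L[ℂ] W).comp (a₁.comp (g : W →L[ℂ] W))‖ < ε ∧
      ‖(g.symm : W →L[ℂ] W).comp (a₂.comp (g : W →L[ℂ] W))‖ < ε := by
    intro ε hε
    obtain ⟨_, ⟨g, rfl⟩, hg⟩ := Metric.mem_closure_iff.1 h0 ε hε
    simp only [Prod.dist_eq, dist_zero_left, max_lt_iff] at hg
    exact ⟨g, hg.1, hg.2.1⟩
  refine ⟨a₁.isNilpotent_of_forall_exists_norm_conj_lt fun ε hε => (small ε hε).imp fun _ h => h.1,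
    a₂.isNilpotent_of_forall_exists_norm_conj_lt fun ε hε => (small ε hε).imp fun _ h => h.2,
    wordSpan a₁ a₂ b, fun _ => cond_apply_mem_wordSpan a₁ a₂ b true,
    fun _ => cond_apply_mem_wordSpan a₁ a₂ b false, apply_mem_wordSpan a₁ a₂ b,
    fun _ => apply_eq_zero_of_mem_wordSpan a₁ a₂ b c fun l u => ?_⟩
  let F : (W →L[ℂ] W) × (W →L[ℂ] W) × ((Fin r → ℂ) →L[ℂ] W) × (W →L[ℂ] (Fin r → ℂ)) →
      (Fin r → ℂ) := fun p => p.2.2.2 (wordEval p.1 p.2.1 l (p.2.2.1 u))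
  have hF : Continuous F := by
    have hw : Continuous fun p : (W →L[ℂ] W) × (W →L[ℂ] W) × ((Fin r → ℂ) →L[ℂ] W) ×
        (W →L[ℂ] (Fin r → ℂ)) => wordEval p.1 p.2.1 l :=
      (continuous_wordEval l).comp (continuous_fst.prodMk continuous_snd.fst)
    exact continuous_snd.snd.snd.clm_apply
      (hw.clm_apply (continuous_snd.snd.fst.clm_apply continuous_const))
  have hmem := closure_minimal (t := {p | F p = c (wordEval a₁ a₂ l (b u))}) ?_
    (isClosed_eq hF continuous_const) h0
  · simpa [F] using Eq.symm hmem
  · rintro _ ⟨g, rfl⟩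
    simp [F, wordEval_conj_apply]
end
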